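/- Let 𝕁 be an interval of the form ℝ, (α,∞) or [α,∞) and X a Banach space. Then the following chain of inclusions holds: ℰ_ub(𝕁,X) ⊆ M ℰ_ub(𝕁,X) ⊆ ℰ(𝕁,X) ⊆ M² ℰ_ub(𝕁,X) ⊆ M ℰ(𝕁,X). -/

import Mathlib

open MeasureTheory Set

/-- The mean `M_h φ(t) = (1/h) ∫₀^h φ(t+s) ds`. -/
noncomputable def meanM {X : Type*} [NormedAddCommGroup X] [NormedSpace ℝ X]
    (h : ℝ) (φ : ℝ → X) : ℝ → X :=
  fun t => (1 / h) • ∫ s in (0 : ℝ)..h, φ (t + s)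

/-- The mean class `M𝒜 = {φ ∈ L¹_loc(𝕁,X) : M_h φ ∈ 𝒜 for all h > 0}`. -/
def meanClass {X : Type*} [NormedAddCommGroup X] [NormedSpace ℝ X]
    (J : Set ℝ) (A : Set (ℝ → X)) : Set (ℝ → X) :=
  {φ | LocallyIntegrableOn φ J ∧ ∀ h : ℝ, 0 < h → meanM h φ ∈ A}

/-- `a` is the ergodic mean of `φ` on `𝕁`: `sup_{x∈𝕁} ‖M_T φ(x) − a‖ → 0` as `T → ∞`. -/
noncomputable def IsErgodicMean {X : Type*} [NormedAddCommGroup X] [NormedSpace ℝ X]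
    (J : Set ℝ) (φ : ℝ → X) (a : X) : Prop :=
  ∀ ε : ℝ, 0 < ε → ∃ T₀ : ℝ, ∀ T ≥ T₀, ∀ x ∈ J, ‖meanM T φ x - a‖ ≤ ε

/-- The ergodic class `ℰ(𝕁,X)`. -/
noncomputable def ergE {X : Type*} [NormedAddCommGroup X] [NormedSpace ℝ X]
    (J : Set ℝ) : Set (ℝ → X) :=
  {φ | LocallyIntegrableOn φ J ∧ ∃ a : X, IsErgodicMean J φ a}

/-- `C_ub(𝕁,X)`: bounded uniformly continuous functions on `𝕁`. -/
def Cub {X : Type*} [NormedAddCommGroup X] (J : Set ℝ) : Set (ℝ → X) :=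
  {f | UniformContinuousOn f J ∧ ∃ C : ℝ, ∀ t ∈ J, ‖f t‖ ≤ C}

lemma IsUpperSet.intervalIntegrable_of_locallyIntegrableOn {X : Type*}
    [NormedAddCommGroup X] {J : Set ℝ} {φ : ℝ → X} (hJ : IsUpperSet J)
    (hφ : LocallyIntegrableOn φ J) {x y : ℝ} (hx : x ∈ J) (hy : y ∈ J) :
    IntervalIntegrable φ volume x y := by
  rw [intervalIntegrable_iff']
  refine hφ.integrableOn_compact_subset ?_ isCompact_uIcc
  intro u hu
  refine hJ hu.1 ?_
  rcases min_choice x y with h | h <;> rw [h] <;> assumption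

section MeanLemmas

variable {X : Type*} [NormedAddCommGroup X] [NormedSpace ℝ X] {J : Set ℝ} {φ : ℝ → X}

lemma meanM_eq (h : ℝ) (φ : ℝ → X) (x : ℝ) :
    meanM h φ x = (1 / h) • ∫ u in x..x + h, φ u := by
  simp [meanM, intervalIntegral.integral_comp_add_left]

lemma continuousOn_primitive_of_isUpperSet (hJ : IsUpperSet J)
    (hφ : LocallyIntegrableOn φ J) {c : ℝ} (hc : c ∈ J) :
    ContinuousOn (fun u => ∫ t in c..u, φ t) J := by
  intro x hx
  obtain ⟨d, hd, hdx, hdc, hnhds⟩ :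
      ∃ d ∈ J, d ≤ x ∧ d ≤ c ∧ Icc d (max x c + 1) ∈ nhdsWithin x J := by
    have hlt : x < max x c + 1 := (le_max_left x c).trans_lt (lt_add_one _)
    by_cases hmin : ∃ d ∈ J, d < x
    · obtain ⟨d, hd, hdx⟩ := hmin
      refine ⟨min d c, ?_, (min_le_left _ _).trans hdx.le, min_le_right _ _, ?_⟩
      · rcases min_choice d c with h | h <;> rw [h] <;> assumption
      · exact mem_nhdsWithin_of_mem_nhds
          (Icc_mem_nhds ((min_le_left _ _).trans_lt hdx) hlt)
    · push Not at hmin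
      refine ⟨x, hx, le_rfl, hmin c hc, ?_⟩
      filter_upwards [self_mem_nhdsWithin, mem_nhdsWithin_of_mem_nhds (Iio_mem_nhds hlt)]
        with u hu hu'
      exact ⟨hmin u hu, le_of_lt hu'⟩
  have hle : d ≤ max x c + 1 := by linarith [le_max_left x c]
  have hcont := intervalIntegral.continuousOn_primitive_interval'
    (hJ.intervalIntegrable_of_locallyIntegrableOn hφ hd (hJ hle hd)) (a := c)
    (by rw [uIcc_of_le hle]; exact ⟨hdc, by linarith [le_max_right x c]⟩)
  rw [uIcc_of_le hle] at hcont
  exact (hcont x ⟨hdx, by linarith [le_max_left x c]⟩).mono_of_mem_nhdsWithin hnhds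

lemma integral_eq_primitive_sub (hJ : IsUpperSet J) (hφ : LocallyIntegrableOn φ J)
    {c x y : ℝ} (hc : c ∈ J) (hx : x ∈ J) (hy : y ∈ J) :
    ∫ u in x..y, φ u = (∫ u in c..y, φ u) - ∫ u in c..x, φ u :=
  (intervalIntegral.integral_interval_sub_left
    (hJ.intervalIntegrable_of_locallyIntegrableOn hφ hc hy)
    (hJ.intervalIntegrable_of_locallyIntegrableOn hφ hc hx)).symm

lemma continuousOn_meanM (hJ : IsUpperSet J) (hφ : LocallyIntegrableOn φ J)
    {h : ℝ} (hh : 0 ≤ h) : ContinuousOn (meanM h φ) J := by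
  rcases J.eq_empty_or_nonempty with rfl | ⟨c, hc⟩
  · exact continuousOn_empty _
  have hadd : ∀ x ∈ J, x + h ∈ J := fun x hx => hJ (by linarith) hx
  have hF := continuousOn_primitive_of_isUpperSet hJ hφ hc
  refine ((hF.comp (by fun_prop : Continuous fun x : ℝ => x + h).continuousOn hadd).sub
    hF).const_smul (1 / h) |>.congr fun x hx => ?_
  simp only [meanM_eq, integral_eq_primitive_sub hJ hφ hc hx (hadd x hx)]
  rfl

lemma locallyIntegrableOn_meanM (hJ : IsUpperSet J) (hφ : LocallyIntegrableOn φ J)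
    {h : ℝ} (hh : 0 ≤ h) : LocallyIntegrableOn (meanM h φ) J :=
  (continuousOn_meanM hJ hφ hh).locallyIntegrableOn hJ.ordConnected.measurableSet

lemma meanM_meanM (hJ : IsUpperSet J) (hφ : LocallyIntegrableOn φ J) {T h x : ℝ}
    (hT : 0 ≤ T) (hh : 0 ≤ h) (hx : x ∈ J) :
    meanM T (meanM h φ) x =
      (1 / T) • (1 / h) • ((∫ u in x + h..x + T + h, ∫ t in x..u, φ t)
        - ∫ u in x..x + T, ∫ t in x..u, φ t) := by
  have hF := continuousOn_primitive_of_isUpperSet hJ hφ hx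
  have hmem : ∀ u, x ≤ u → u ∈ J := fun u hu => hJ hu hx
  have hsub : uIcc x (x + T) ⊆ J := fun u hu => by
    rw [uIcc_of_le (by linarith)] at hu
    exact hmem u hu.1
  have hEq : ∫ u in x..x + T, meanM h φ u = ∫ u in x..x + T,
      (1 / h) • ((∫ t in x..u + h, φ t) - ∫ t in x..u, φ t) := by
    refine intervalIntegral.integral_congr fun u hu => ?_
    have hu' := hsub hu
    simp only [meanM_eq,
      integral_eq_primitive_sub hJ hφ hx hu' (hJ (by linarith : u ≤ u + h) hu')]
  rw [meanM_eq, hEq, intervalIntegral.integral_smul, intervalIntegral.integral_sub,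
    intervalIntegral.integral_comp_add_right (fun u => ∫ t in x..u, φ t)]
  · refine ContinuousOn.intervalIntegrable ?_
    exact hF.comp (by fun_prop : Continuous fun u : ℝ => u + h).continuousOn
      fun u hu => hJ (by linarith) (hsub hu)
  · exact (hF.mono hsub).intervalIntegrable

lemma meanM_comm (hJ : IsUpperSet J) (hφ : LocallyIntegrableOn φ J) {T h x : ℝ}
    (hT : 0 ≤ T) (hh : 0 ≤ h) (hx : x ∈ J) :
    meanM T (meanM h φ) x = meanM h (meanM T φ) x := by
  have hF := (continuousOn_primitive_of_isUpperSet hJ hφ hx).locallyIntegrableOn (μ := volume)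
    hJ.ordConnected.measurableSet
  have hmem : ∀ u, x ≤ u → u ∈ J := fun u hu => hJ hu hx
  rw [meanM_meanM hJ hφ hT hh hx, meanM_meanM hJ hφ hh hT hx, smul_comm,
    integral_eq_primitive_sub hJ hF hx (hmem (x + h) (by linarith))
      (hmem (x + T + h) (by linarith)),
    integral_eq_primitive_sub hJ hF hx (hmem (x + T) (by linarith))
      (hmem (x + h + T) (by linarith)), add_right_comm x T h]
  congr 2
  abel

lemma norm_meanM_sub_le [CompleteSpace X] {h x ε : ℝ} (hh : 0 < h) {a : X}
    (hφ : IntervalIntegrable φ volume x (x + h))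
    (hbound : ∀ y ∈ Icc x (x + h), ‖φ y - a‖ ≤ ε) : ‖meanM h φ x - a‖ ≤ ε := by
  have hint : meanM h φ x - a = (1 / h) • ∫ u in x..x + h, (φ u - a) := by
    rw [meanM_eq, intervalIntegral.integral_sub hφ intervalIntegrable_const, smul_sub,
      intervalIntegral.integral_const, add_sub_cancel_left, smul_smul, one_div_mul_cancel hh.ne',
      one_smul]
  have hle : ‖∫ u in x..x + h, (φ u - a)‖ ≤ ε * |x + h - x| := by
    refine intervalIntegral.norm_integral_le_of_norm_le_const fun u hu => hbound u ?_
    rw [uIoc_of_le (by linarith)] at hu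
    exact Ioc_subset_Icc_self hu
  rw [add_sub_cancel_left, abs_of_pos hh] at hle
  rw [hint, norm_smul, Real.norm_of_nonneg (by positivity), one_div, inv_mul_le_iff₀ hh]
  linarith

lemma IsErgodicMean.meanM [CompleteSpace X] (hJ : IsUpperSet J) (hφ : LocallyIntegrableOn φ J)
    {a : X} (ha : IsErgodicMean J φ a) {h : ℝ} (hh : 0 < h) :
    IsErgodicMean J (meanM h φ) a := by
  intro ε hε
  obtain ⟨T₀, hT₀⟩ := ha ε hε
  refine ⟨max T₀ 1, fun T hT x hx => ?_⟩
  have hT0 : 0 ≤ T := zero_le_one.trans ((le_max_right _ _).trans hT)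
  rw [meanM_comm hJ hφ hT0 hh.le hx]
  exact norm_meanM_sub_le hh
    (hJ.intervalIntegrable_of_locallyIntegrableOn (locallyIntegrableOn_meanM hJ hφ hT0) hx
      (hJ (by linarith) hx))
    fun y hy => hT₀ T ((le_max_left _ _).trans hT) y (hJ hy.1 hx)

lemma meanM_mem_ergE [CompleteSpace X] (hJ : IsUpperSet J) (hφ : φ ∈ ergE J)
    {h : ℝ} (hh : 0 < h) : meanM h φ ∈ ergE J :=
  ⟨locallyIntegrableOn_meanM hJ hφ.1 hh.le, hφ.2.choose, hφ.2.choose_spec.meanM hJ hφ.1 hh⟩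

lemma meanM_mem_Cub (hJ : IsUpperSet J) (hφ : LocallyIntegrableOn φ J)
    {C : ℝ} (hC : ∀ x ∈ J, ‖φ x‖ ≤ C) {h : ℝ} (hh : 0 < h) : meanM h φ ∈ Cub J := by
  have hadd : ∀ x ∈ J, x + h ∈ J := fun x hx => hJ (by linarith) hx
  have hint : ∀ x ∈ J, ∀ y ∈ J, ‖∫ u in x..y, φ u‖ ≤ C * |y - x| := by
    intro x hx y hy
    refine intervalIntegral.norm_integral_le_of_norm_le_const fun u hu => hC u ?_
    refine hJ hu.1.le ?_
    rcases min_choice x y with h | h <;> rw [h] <;> assumption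
  constructor
  · refine (LipschitzOnWith.of_dist_le_mul (K := (2 * C / h).toNNReal)
      fun x hx y hy => ?_).uniformContinuousOn
    have hC0 : 0 ≤ C := (norm_nonneg _).trans (hC x hx)
    rw [Real.coe_toNNReal _ (by positivity), dist_eq_norm, Real.dist_eq, meanM_eq, meanM_eq,
      ← smul_sub, integral_eq_primitive_sub hJ hφ hx hx (hadd x hx),
      integral_eq_primitive_sub hJ hφ hx hy (hadd y hy), norm_smul,
      Real.norm_of_nonneg (by positivity)]
    have h₁ := hint _ (hadd y hy) _ (hadd x hx)
    rw [integral_eq_primitive_sub hJ hφ hx (hadd y hy) (hadd x hx)] at h₁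
    have h₂ := hint _ hx _ hy
    rw [add_sub_add_right_eq_sub] at h₁
    rw [abs_sub_comm] at h₂
    have h₃ := norm_add_le ((∫ u in x..x + h, φ u) - ∫ u in x..y + h, φ u) (∫ u in x..y, φ u)
    have h₄ : 1 / h * (2 * C * |x - y|) = 2 * C / h * |x - y| := by ring
    rw [← h₄, intervalIntegral.integral_same, sub_zero]
    gcongr
    rw [show ∀ p q r : X, p - (q - r) = p - q + r by intros; abel]
    linarith
  · refine ⟨C, fun x hx => ?_⟩
    have := hint x hx _ (hadd x hx)
    rw [add_sub_cancel_left, abs_of_pos hh] at this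
    rw [meanM_eq, norm_smul, Real.norm_of_nonneg (by positivity), one_div, inv_mul_le_iff₀ hh]
    linarith

lemma norm_integral_le_of_norm_integral_add_le (hJ : IsUpperSet J)
    (hφ : LocallyIntegrableOn φ J) {b s C : ℝ} (hb : 0 ≤ b) (hs : 0 ≤ s)
    (h₀ : ∀ x ∈ J, ‖∫ u in x..x + b, φ u‖ ≤ C) (h₁ : ∀ x ∈ J, ‖∫ u in x..x + (b + s), φ u‖ ≤ C)
    {x : ℝ} (hx : x ∈ J) : ‖∫ u in x..x + s, φ u‖ ≤ 2 * C := by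
  have hxs : x + s ∈ J := hJ (by linarith) hx
  have hxsb : x + (b + s) ∈ J := hJ (by linarith) hx
  have h₂ := h₀ _ hxs
  rw [show x + s + b = x + (b + s) by ring, integral_eq_primitive_sub hJ hφ hx hxs hxsb] at h₂
  have h₃ := norm_sub_le (∫ u in x..x + (b + s), φ u)
    ((∫ u in x..x + (b + s), φ u) - ∫ u in x..x + s, φ u)
  rw [sub_sub_cancel] at h₃
  linarith [h₁ x hx]

/-- By the Baire category theorem, pointwise bounded increments of the primitive are uniformly
bounded for small step sizes. -/
lemma exists_norm_integral_le_of_forall_bounded (hJ : IsUpperSet J)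
    (hφ : LocallyIntegrableOn φ J)
    (hbdd : ∀ s, 0 < s → ∃ C : ℝ, ∀ x ∈ J, ‖∫ u in x..x + s, φ u‖ ≤ C) :
    ∃ δ > 0, ∃ C : ℝ, ∀ s ∈ Icc 0 δ, ∀ x ∈ J, ‖∫ u in x..x + s, φ u‖ ≤ C := by
  let F : ℕ → Set ℝ := fun n => {s | ∀ x ∈ J, ‖∫ u in x..x + |s|, φ u‖ ≤ n}
  have hclosed : ∀ n, IsClosed (F n) := by
    intro n
    have : F n = ⋂ x ∈ J, {s | ‖∫ u in x..x + |s|, φ u‖ ≤ n} := by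
      ext s; simp [F]
    rw [this]
    refine isClosed_biInter fun x hx => isClosed_le (Continuous.norm ?_) continuous_const
    refine (continuousOn_primitive_of_isUpperSet hJ hφ hx).comp_continuous
      (f := fun s : ℝ => x + |s|) (by fun_prop) fun s => hJ (by simp) hx
  have hcover : ⋃ n, F n = univ := by
    refine eq_univ_of_forall fun s => mem_iUnion.2 ?_
    rcases eq_or_ne s 0 with rfl | hs
    · exact ⟨0, fun x _ => by simp⟩
    · obtain ⟨C, hC⟩ := hbdd |s| (abs_pos.2 hs)
      obtain ⟨n, hn⟩ := exists_nat_ge C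
      exact ⟨n, fun x hx => (hC x hx).trans hn⟩
  obtain ⟨n, s₀, hs₀⟩ := nonempty_interior_of_iUnion_of_closed hclosed hcover
  obtain ⟨δ, hδ, hball⟩ := Metric.isOpen_iff.1 isOpen_interior s₀ hs₀
  have key : ∀ s ∈ Icc 0 (δ / 2), ∀ x ∈ J, ‖∫ u in x..x + (|s₀| + s), φ u‖ ≤ n := by
    intro s hs x hx
    have hmem : ∀ t, |t| = s → s₀ + t ∈ F n := fun t ht => interior_subset <| hball <| by
      rw [Metric.mem_ball, Real.dist_eq, add_sub_cancel_left, ht]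
      linarith [hs.2]
    rcases le_total 0 s₀ with h | h
    · have := hmem s (abs_of_nonneg hs.1) x hx
      rwa [abs_of_nonneg (by linarith [hs.1]), ← abs_of_nonneg h] at this
    · have := hmem (-s) (by rw [abs_neg, abs_of_nonneg hs.1]) x hx
      rwa [abs_of_nonpos (by linarith [hs.1]), neg_add, neg_neg, ← abs_of_nonpos h] at this
  refine ⟨δ / 2, by positivity, 2 * n, fun s hs x hx => ?_⟩
  refine norm_integral_le_of_norm_integral_add_le hJ hφ (abs_nonneg s₀) hs.1 ?_ (key s hs) hx
  simpa using key 0 ⟨le_rfl, by positivity⟩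

lemma IsErgodicMean.of_meanM [CompleteSpace X] (hJ : IsUpperSet J)
    (hφ : LocallyIntegrableOn φ J) {δ C : ℝ} (hδ : 0 < δ) {a : X}
    (ha : IsErgodicMean J (_root_.meanM δ φ) a)
    (hC : ∀ s ∈ Icc 0 δ, ∀ x ∈ J, ‖∫ u in x..x + s, φ u‖ ≤ C) : IsErgodicMean J φ a := by
  intro ε hε
  obtain ⟨T₀, hT₀⟩ := ha (ε / 2) (by positivity)
  refine ⟨max T₀ (max 1 (4 * C / ε)), fun T hT x hx => ?_⟩
  have hT₁ : T₀ ≤ T := (le_max_left _ _).trans hT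
  have hT₂ : 0 < T := zero_lt_one.trans_le ((le_max_left _ _).trans ((le_max_right _ _).trans hT))
  have hT₃ : 4 * C / ε ≤ T := (le_max_right _ _).trans ((le_max_right _ _).trans hT)
  have hclose : ‖_root_.meanM δ (_root_.meanM T φ) x - _root_.meanM T φ x‖ ≤ ε / 2 := by
    refine norm_meanM_sub_le hδ (hJ.intervalIntegrable_of_locallyIntegrableOn
      (locallyIntegrableOn_meanM hJ hφ hT₂.le) hx (hJ (by linarith) hx)) fun y hy => ?_
    have hyJ : y ∈ J := hJ hy.1 hx
    have hxT : x + T ∈ J := hJ (by linarith) hx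
    have hyT : y + T ∈ J := hJ (by linarith) hyJ
    have hs : y - x ∈ Icc 0 δ := ⟨by linarith [hy.1], by linarith [hy.2]⟩
    have h₁ := hC _ hs x hx
    have h₂ := hC _ hs _ hxT
    rw [add_sub_cancel] at h₁
    rw [show x + T + (y - x) = y + T by ring, integral_eq_primitive_sub hJ hφ hx hxT hyT] at h₂
    have h₃ := norm_sub_le ((∫ u in x..y + T, φ u) - ∫ u in x..x + T, φ u) (∫ u in x..y, φ u)
    rw [meanM_eq, meanM_eq, ← smul_sub, integral_eq_primitive_sub hJ hφ hx hyJ hyT, norm_smul,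
      Real.norm_of_nonneg (by positivity), one_div, inv_mul_le_iff₀ hT₂, sub_right_comm]
    rw [div_le_iff₀ hε] at hT₃
    linarith
  have hmean := hT₀ T hT₁ x hx
  rw [meanM_comm hJ hφ hT₂.le hδ.le hx] at hmean
  have := norm_sub_le_norm_sub_add_norm_sub (_root_.meanM T φ x)
    (_root_.meanM δ (_root_.meanM T φ) x) a
  rw [norm_sub_rev] at hclose
  linarith

lemma exists_norm_meanM_le_of_mem_ergE (hJ : IsUpperSet J) (hφ : φ ∈ ergE J) {h : ℝ}
    (hh : 0 < h) : ∃ C : ℝ, ∀ x ∈ J, ‖meanM h φ x‖ ≤ C := by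
  obtain ⟨hloc, a, ha⟩ := hφ
  obtain ⟨T₀, hT₀⟩ := ha 1 one_pos
  have hbdd : ∀ T, 0 < T → T₀ ≤ T → ∀ x ∈ J, ‖∫ u in x..x + T, φ u‖ ≤ T * (‖a‖ + 1) := by
    intro T hT hT' x hx
    have h₁ := hT₀ T hT' x hx
    have h₂ : ‖meanM T φ x‖ ≤ ‖a‖ + 1 := by
      linarith [norm_sub_norm_le (meanM T φ x) a]
    rwa [meanM_eq, norm_smul, Real.norm_of_nonneg (by positivity), one_div,
      inv_mul_le_iff₀ hT] at h₂
  set T := max T₀ 1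
  have hT : 0 < T := zero_lt_one.trans_le (le_max_right _ _)
  refine ⟨1 / h * (2 * ((T + h) * (‖a‖ + 1))), fun x hx => ?_⟩
  rw [meanM_eq, norm_smul, Real.norm_of_nonneg (by positivity)]
  gcongr
  refine norm_integral_le_of_norm_integral_add_le hJ hloc hT.le hh.le (fun y hy => ?_)
    (hbdd _ (by positivity) ((le_max_left _ _).trans (by linarith))) hx
  refine (hbdd T hT (le_max_left _ _) y hy).trans ?_
  gcongr
  linarith

lemma meanClass_mono {A B : Set (ℝ → X)} (hAB : A ⊆ B) : meanClass J A ⊆ meanClass J B :=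
  fun _ hφ => ⟨hφ.1, fun h hh => hAB (hφ.2 h hh)⟩

lemma ergE_inter_Cub_subset_meanClass [CompleteSpace X] (hJ : IsUpperSet J) :
    ergE (X := X) J ∩ Cub J ⊆ meanClass J (ergE J ∩ Cub J) :=
  fun _ hφ => ⟨hφ.1.1, fun _ hh => ⟨meanM_mem_ergE hJ hφ.1 hh,
    meanM_mem_Cub hJ hφ.1.1 hφ.2.2.choose_spec hh⟩⟩

lemma meanClass_ergE_inter_Cub_subset [CompleteSpace X] (hJ : IsUpperSet J) :
    meanClass J (ergE (X := X) J ∩ Cub J) ⊆ ergE J := by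
  intro φ hφ
  obtain ⟨δ, hδ, C, hC⟩ := exists_norm_integral_le_of_forall_bounded hJ hφ.1 fun s hs => by
    obtain ⟨C, hC⟩ := (hφ.2 s hs).2.2
    refine ⟨s * C, fun x hx => ?_⟩
    have := hC x hx
    rwa [meanM_eq, norm_smul, Real.norm_of_nonneg (by positivity), one_div,
      inv_mul_le_iff₀ hs] at this
  obtain ⟨a, ha⟩ := (hφ.2 δ hδ).1.2
  exact ⟨hφ.1, a, ha.of_meanM hJ hφ.1 hδ hC⟩

lemma ergE_subset_meanClass_meanClass [CompleteSpace X] (hJ : IsUpperSet J) :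
    ergE (X := X) J ⊆ meanClass J (meanClass J (ergE J ∩ Cub J)) := by
  intro φ hφ
  refine ⟨hφ.1, fun h hh => ?_⟩
  have hloc := locallyIntegrableOn_meanM hJ hφ.1 hh.le
  obtain ⟨C, hC⟩ := exists_norm_meanM_le_of_mem_ergE hJ hφ hh
  exact ⟨hloc, fun k hk =>
    ⟨meanM_mem_ergE hJ (meanM_mem_ergE hJ hφ hh) hk, meanM_mem_Cub hJ hloc hC hk⟩⟩

end MeanLemmas

/-- part of Proposition 7.1.  The chain
`ℰ_ub ⊆ Mℰ_ub ⊆ ℰ ⊆ M²ℰ_ub ⊆ Mℰ` holds, where `ℰ_ub = ℰ ∩ C_ub`. -/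
theorem prop_7_1_chain {X : Type*} [NormedAddCommGroup X] [NormedSpace ℝ X]
    [CompleteSpace X]
    (J : Set ℝ)
    (hJ : J = Set.univ ∨ (∃ α : ℝ, J = Set.Ioi α) ∨ (∃ α : ℝ, J = Set.Ici α)) :
    (ergE (X := X) J ∩ Cub (X := X) J
        ⊆ meanClass J (ergE (X := X) J ∩ Cub (X := X) J)) ∧
    (meanClass J (ergE (X := X) J ∩ Cub (X := X) J) ⊆ ergE (X := X) J) ∧
    (ergE (X := X) J
        ⊆ meanClass J (meanClass J (ergE (X := X) J ∩ Cub (X := X) J))) ∧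
    (meanClass J (meanClass J (ergE (X := X) J ∩ Cub (X := X) J))
        ⊆ meanClass J (ergE (X := X) J)) := by
  have hup : IsUpperSet J := by
    rcases hJ with rfl | ⟨α, rfl⟩ | ⟨α, rfl⟩
    exacts [isUpperSet_univ, isUpperSet_Ioi α, isUpperSet_Ici α]
  exact ⟨ergE_inter_Cub_subset_meanClass hup, meanClass_ergE_inter_Cub_subset hup,
    ergE_subset_meanClass_meanClass hup, meanClass_mono (meanClass_ergE_inter_Cub_subset hup)⟩
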